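/- For every ε > 0 there exists C > 0 such that for every real N ≥ 1 and every v ∈ ℓ²(ℤ; ℂ): define, for n ∈ ℤ, Q(n) := ∑ over all (n₁, n₂, n₃, m₁, m₂, m₃, p₁, p₂, p₃) ∈ ℤ⁹ satisfying n = n₁ − n₂ + n₃ with n₂ ∉ {n₁, n₃}, n₁ = m₁ − m₂ + m₃ with m₂ ∉ {m₁, m₃}, m₁ = p₁ − p₂ + p₃ with p₂ ∉ {p₁, p₃}, and with μ₁ := 2(n − n₁)(n − n₃), μ₂ := 2(n₁ − m₁)(n₁ − m₃), μ₃ := 2(m₁ − p₁)(m₁ − p₃), μ̃₂ := μ₁ + μ₂, μ̃₃ := μ̃₂ + μ₃, subject to |μ₁| > N, |μ̃₂| > 125 · |μ₁|^{1 − 1/100}, and |μ̃₃| ≤ 343 · max(|μ̃₂|^{1 − 1/100}, |μ₁|^{1 − 1/100}), of (1/(|μ₁| · |μ̃₂|)) · |v_{p₁}| |v_{p₂}| |v_{p₃}| |v_{m₂}| |v_{m₃}| |v_{n₂}| |v_{n₃}|. Then Q is finite for every n, belongs to ℓ²(ℤ), and ‖Q‖ ≤ C N^{−1/2 + ε} ‖v‖⁷.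 -/

import Mathlib

open scoped BigOperators

/-- The ℓ²(ℤ;ℂ) norm `(∑ₙ |vₙ|²)^{1/2}`. -/
noncomputable def l2norm (v : ℤ → ℂ) : ℝ := Real.sqrt (∑' n : ℤ, ‖v n‖ ^ 2)

/-- Membership in ℓ²(ℤ;ℂ). -/
def Memℓ2 (v : ℤ → ℂ) : Prop := Summable fun n : ℤ => ‖v n‖ ^ 2

/-- Three generations of frequencies: `q.1 = (n₁,n₂,n₃)`, `q.2.1 = (m₁,m₂,m₃)`,
`q.2.2 = (p₁,p₂,p₃)`. -/
abbrev Triple3 := (ℤ × ℤ × ℤ) × (ℤ × ℤ × ℤ) × (ℤ × ℤ × ℤ)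

/-- First-generation phase `μ₁ = 2(n − n₁)(n − n₃)`. -/
def mu1 (n : ℤ) (q : Triple3) : ℤ := 2 * (n - q.1.1) * (n - q.1.2.2)

/-- Second-generation phase `μ₂ = 2(n₁ − m₁)(n₁ − m₃)`. -/
def mu2 (q : Triple3) : ℤ := 2 * (q.1.1 - q.2.1.1) * (q.1.1 - q.2.1.2.2)

/-- Third-generation phase `μ₃ = 2(m₁ − p₁)(m₁ − p₃)`. -/
def mu3 (q : Triple3) : ℤ := 2 * (q.2.1.1 - q.2.2.1) * (q.2.1.1 - q.2.2.2.2)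

/-- Accumulated second phase `μ̃₂ = μ₁ + μ₂`. -/
def mut2 (n : ℤ) (q : Triple3) : ℤ := mu1 n q + mu2 q

/-- Accumulated third phase `μ̃₃ = μ̃₂ + μ₃`. -/
def mut3 (n : ℤ) (q : Triple3) : ℤ := mut2 n q + mu3 q

/-- Three-generation frequencies with `|μ₁| > N`, `|μ̃₂| > 125 |μ₁|^{1−1/100}`, and
`|μ̃₃| ≤ 343 max(|μ̃₂|^{1−1/100}, |μ₁|^{1−1/100})` (nearly resonant region `C₂`). -/
def cond11 (N : ℝ) (n : ℤ) (q : Triple3) : Prop :=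
  n = q.1.1 - q.1.2.1 + q.1.2.2 ∧ q.1.2.1 ≠ q.1.1 ∧ q.1.2.1 ≠ q.1.2.2 ∧
  q.1.1 = q.2.1.1 - q.2.1.2.1 + q.2.1.2.2 ∧ q.2.1.2.1 ≠ q.2.1.1 ∧ q.2.1.2.1 ≠ q.2.1.2.2 ∧
  q.2.1.1 = q.2.2.1 - q.2.2.2.1 + q.2.2.2.2 ∧ q.2.2.2.1 ≠ q.2.2.1 ∧ q.2.2.2.1 ≠ q.2.2.2.2 ∧
  N < |((mu1 n q : ℤ) : ℝ)| ∧
  125 * |((mu1 n q : ℤ) : ℝ)| ^ ((1:ℝ) - 1/100) < |((mut2 n q : ℤ) : ℝ)| ∧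
  |((mut3 n q : ℤ) : ℝ)| ≤ 343 * max (|((mut2 n q : ℤ) : ℝ)| ^ ((1:ℝ) - 1/100))
      (|((mu1 n q : ℤ) : ℝ)| ^ ((1:ℝ) - 1/100))

/-- The summand `(1/(|μ₁| |μ̃₂|)) |v_{p₁}| |v_{p₂}| |v_{p₃}| |v_{m₂}| |v_{m₃}| |v_{n₂}| |v_{n₃}|`. -/
noncomputable def term11 (v : ℤ → ℂ) (n : ℤ) (q : Triple3) : ℝ :=
  1 / (|((mu1 n q : ℤ) : ℝ)| * |((mut2 n q : ℤ) : ℝ)|) *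
    (‖v q.2.2.1‖ * ‖v q.2.2.2.1‖ * ‖v q.2.2.2.2‖ *
      ‖v q.2.1.2.1‖ * ‖v q.2.1.2.2‖ * ‖v q.1.2.1‖ * ‖v q.1.2.2‖)

/-- The majorant `Q(n)` of the nearly resonant septic term `N⁽³⁾₁` of the third generation. -/
noncomputable def Q11 (N : ℝ) (v : ℤ → ℂ) (n : ℤ) : ℝ :=
  ∑' q : {q : Triple3 // cond11 N n q}, term11 v n q.1

theorem exists_card_divisors_le_rpow {δ : ℝ} (hδ : 0 < δ) :
    ∃ C > (0:ℝ), ∀ n : ℕ, n ≠ 0 → (n.divisors.card : ℝ) ≤ C * (n:ℝ) ^ δ := by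
  set K : ℝ := 1 + 2 / δ with hK
  have hK1 : 1 ≤ K := by rw [hK]; have := div_pos two_pos hδ; linarith
  obtain ⟨P, hP⟩ := exists_nat_gt ((2:ℝ) ^ (1 / δ))
  have hlocal : ∀ p e : ℕ, p.Prime →
      ((e + 1 : ℕ) : ℝ) ≤ (if p < P then K else 1) * ((p ^ e : ℕ) : ℝ) ^ δ := by
    intro p e hp
    have hp2 : (2:ℝ) ≤ p := by exact_mod_cast hp.two_le
    have hswap : ((p ^ e : ℕ) : ℝ) ^ δ = ((p:ℝ) ^ δ) ^ e := by
      push_cast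
      rw [← Real.rpow_natCast, ← Real.rpow_natCast, ← Real.rpow_mul (by positivity),
        ← Real.rpow_mul (by positivity), mul_comm]
    rw [hswap]
    have hlog : 1 + δ / 2 ≤ (p:ℝ) ^ δ := by
      have h2 : (1:ℝ) / 2 ≤ Real.log 2 := by linarith [Real.log_two_gt_d9]
      calc 1 + δ / 2 ≤ Real.log 2 * δ + 1 := by nlinarith
        _ ≤ Real.exp (Real.log 2 * δ) := Real.add_one_le_exp _
        _ = 2 ^ δ := (Real.rpow_def_of_pos two_pos δ).symm
        _ ≤ (p:ℝ) ^ δ := Real.rpow_le_rpow two_pos.le hp2 hδ.le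
    split_ifs with h
    · have hb : 1 + e * (δ / 2) ≤ ((p:ℝ) ^ δ) ^ e :=
        (one_add_mul_le_pow (by linarith) e).trans (pow_le_pow_left₀ (by linarith) hlog e)
      calc ((e + 1 : ℕ) : ℝ) ≤ K * (1 + e * (δ / 2)) := by
            have : K * (1 + e * (δ / 2)) = e + 1 + 2 / δ + e * δ / 2 := by
              rw [hK]; field_simp; ring
            rw [this]; push_cast; have := div_pos two_pos hδ
            have : 0 ≤ e * δ / 2 := by positivity
            linarith
        _ ≤ _ := by gcongr
    · have h2 : (2:ℝ) ≤ (p:ℝ) ^ δ := by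
        have hPp : (2:ℝ) ^ (1 / δ) ≤ p := hP.le.trans (by exact_mod_cast not_lt.mp h)
        calc (2:ℝ) = ((2:ℝ) ^ (1 / δ)) ^ δ := by
              rw [← Real.rpow_mul two_pos.le, one_div_mul_cancel hδ.ne', Real.rpow_one]
          _ ≤ _ := Real.rpow_le_rpow (by positivity) hPp hδ.le
      rw [one_mul]
      calc ((e + 1 : ℕ) : ℝ) ≤ (2:ℝ) ^ e := by exact_mod_cast Nat.lt_two_pow_self
        _ ≤ _ := pow_le_pow_left₀ two_pos.le h2 e
  refine ⟨K ^ P, by positivity, fun n hn => ?_⟩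
  have hfac : (n:ℝ) ^ δ = ∏ p ∈ n.primeFactors, ((p ^ n.factorization p : ℕ) : ℝ) ^ δ := by
    rw [Real.finsetProd_rpow _ _ (fun _ _ => by positivity), ← Nat.cast_prod]
    congr 2
    exact (Nat.prod_factorization_pow_eq_self hn).symm
  rw [Nat.card_divisors hn, Nat.cast_prod, hfac]
  calc ∏ p ∈ n.primeFactors, ((n.factorization p + 1 : ℕ) : ℝ)
      ≤ ∏ p ∈ n.primeFactors,
          ((if p < P then K else 1) * ((p ^ n.factorization p : ℕ) : ℝ) ^ δ) :=
        Finset.prod_le_prod (fun _ _ => by positivity)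
          fun p hp => hlocal p _ (Nat.prime_of_mem_primeFactors hp)
    _ = (∏ p ∈ n.primeFactors, if p < P then K else 1) *
          ∏ p ∈ n.primeFactors, ((p ^ n.factorization p : ℕ) : ℝ) ^ δ :=
        Finset.prod_mul_distrib
    _ ≤ _ := by
        gcongr
        rw [← Finset.prod_filter, Finset.prod_const]
        refine pow_le_pow_right₀ hK1 ?_
        calc _ ≤ (Finset.range P).card := Finset.card_le_card fun p hp => by
              simpa using (Finset.mem_filter.mp hp).2
          _ = P := Finset.card_range P

/-- The integers dividing `k`, provided `k ≠ 0`. -/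
def intDivisors (k : ℤ) : Finset ℤ :=
  k.natAbs.divisors.image (fun d : ℕ => (d : ℤ)) ∪
    k.natAbs.divisors.image (fun d : ℕ => -(d : ℤ))

theorem mem_intDivisors {k d : ℤ} (hk : k ≠ 0) (hd : d ∣ k) : d ∈ intDivisors k := by
  have h : d.natAbs ∈ k.natAbs.divisors :=
    Nat.mem_divisors.mpr ⟨Int.natAbs_dvd_natAbs.mpr hd, Int.natAbs_ne_zero.mpr hk⟩
  rcases Int.natAbs_eq d with h' | h'
  · exact Finset.mem_union_left _ (Finset.mem_image.mpr ⟨_, h, h'.symm⟩)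
  · exact Finset.mem_union_right _ (Finset.mem_image.mpr ⟨_, h, h'.symm⟩)

theorem exists_card_intDivisors_le_rpow {δ : ℝ} (hδ : 0 < δ) :
    ∃ C > (0:ℝ), ∀ k : ℤ, k ≠ 0 → ((intDivisors k).card : ℝ) ≤ C * |(k:ℝ)| ^ δ := by
  obtain ⟨C, hC, h⟩ := exists_card_divisors_le_rpow hδ
  refine ⟨2 * C, by positivity, fun k hk => ?_⟩
  have h1 : (intDivisors k).card ≤ k.natAbs.divisors.card + k.natAbs.divisors.card :=
    (Finset.card_union_le _ _).trans (add_le_add Finset.card_image_le Finset.card_image_le)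
  have h2 := h k.natAbs (Int.natAbs_ne_zero.mpr hk)
  rw [Nat.cast_natAbs, Int.cast_abs] at h2
  have h3 : ((intDivisors k).card : ℝ) ≤ k.natAbs.divisors.card + k.natAbs.divisors.card := by
    exact_mod_cast h1
  linarith

theorem cond11.mu_ne_zero {N : ℝ} {n : ℤ} {q : Triple3} (h : cond11 N n q) :
    mu1 n q ≠ 0 ∧ mu2 q ≠ 0 ∧ mu3 q ≠ 0 := by
  obtain ⟨h1, h2, h3, h4, h5, h6, h7, h8, h9, -⟩ := h
  simp only [mu1, mu2, mu3, ne_eq, mul_eq_zero, not_or, OfNat.ofNat_ne_zero, not_false_eq_true,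
    true_and]
  omega

/-- Frequencies of the region with prescribed phases are determined by one divisor of each
phase. -/
theorem card_le_of_phases {N : ℝ} {n x y z : ℤ} {S : Finset Triple3}
    (hS : ∀ q ∈ S, cond11 N n q ∧ mu1 n q = x ∧ mu2 q = y ∧ mu3 q = z) :
    S.card ≤ (intDivisors x).card * (intDivisors y).card * (intDivisors z).card := by
  rw [mul_assoc, ← Finset.card_product, ← Finset.card_product]
  refine Finset.card_le_card_of_injOn
    (fun q => (n - q.1.1, q.1.1 - q.2.1.1, q.2.1.1 - q.2.2.1)) ?_ ?_
  · intro q hq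
    obtain ⟨hc, rfl, rfl, rfl⟩ := hS q hq
    obtain ⟨h1, h2, h3⟩ := hc.mu_ne_zero
    simp only [Finset.coe_product, Set.mem_prod, Finset.mem_coe]
    exact ⟨mem_intDivisors h1 ⟨2 * (n - q.1.2.2), by rw [mu1]; ring⟩,
      mem_intDivisors h2 ⟨2 * (q.1.1 - q.2.1.2.2), by rw [mu2]; ring⟩,
      mem_intDivisors h3 ⟨2 * (q.2.1.1 - q.2.2.2.2), by rw [mu3]; ring⟩⟩
  · rintro q hq q' hq' heq
    obtain ⟨hc, h1, h2, h3⟩ := hS q hq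
    obtain ⟨hc', h1', h2', h3'⟩ := hS q' hq'
    obtain ⟨k1, k2, k3⟩ := hc.mu_ne_zero
    obtain ⟨⟨n1, n2, n3⟩, ⟨m1, m2, m3⟩, ⟨p1, p2, p3⟩⟩ := q
    obtain ⟨⟨n1', n2', n3'⟩, ⟨m1', m2', m3'⟩, ⟨p1', p2', p3'⟩⟩ := q'
    obtain ⟨e1, -, -, e2, -, -, e3, -⟩ := hc
    obtain ⟨e1', -, -, e2', -, -, e3', -⟩ := hc'
    simp only [mu1, mu2, mu3, Prod.mk.injEq] at *
    obtain ⟨f1, f2, f3⟩ := heq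
    obtain rfl : n1' = n1 := by omega
    obtain rfl : m1' = m1 := by omega
    obtain rfl : p1' = p1 := by omega
    have g1 := mul_left_cancel₀ (left_ne_zero_of_mul k1) (h1.trans h1'.symm)
    have g2 := mul_left_cancel₀ (left_ne_zero_of_mul k2) (h2.trans h2'.symm)
    have g3 := mul_left_cancel₀ (left_ne_zero_of_mul k3) (h3.trans h3'.symm)
    omega

theorem one_add_le_of_nearly_resonant {δ X Y z : ℝ} (hδ : 0 < δ) (hδ' : δ ≤ 1 / 400)
    (hX : 1 ≤ X) (hXY : X ^ ((1:ℝ) - 1/100) ≤ Y)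
    (hz : z ≤ 343 * max (Y ^ ((1:ℝ) - 1/100)) (X ^ ((1:ℝ) - 1/100))) :
    1 + z ≤ 344 * (X ^ (4 * δ) * Y ^ (1 - 4 * δ)) := by
  have hX0 : 0 < X := by linarith
  have hY : 1 ≤ Y := (Real.one_le_rpow hX (by norm_num)).trans hXY
  have hY0 : 0 < Y := by linarith
  have hx1 : 1 ≤ X ^ (4 * δ) := Real.one_le_rpow hX (by linarith)
  have h1 : Y ^ ((1:ℝ) - 1/100) ≤ X ^ (4 * δ) * Y ^ (1 - 4 * δ) :=
    (Real.rpow_le_rpow_of_exponent_le hY (by linarith)).trans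
      (le_mul_of_one_le_left (by positivity) hx1)
  have h2 : X ^ ((1:ℝ) - 1/100) ≤ X ^ (4 * δ) * Y ^ (1 - 4 * δ) := by
    calc X ^ ((1:ℝ) - 1/100)
        = (X ^ ((1:ℝ) - 1/100)) ^ (4 * δ) * (X ^ ((1:ℝ) - 1/100)) ^ (1 - 4 * δ) := by
          rw [← Real.rpow_add (by positivity)]; simp
      _ ≤ X ^ (4 * δ) * Y ^ (1 - 4 * δ) := by
          refine mul_le_mul ?_ (Real.rpow_le_rpow (by positivity) hXY (by linarith))
            (by positivity) (by positivity)
          refine Real.rpow_le_rpow (by positivity) ?_ (by linarith)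
          exact (Real.rpow_le_rpow_of_exponent_le hX (by norm_num)).trans_eq (Real.rpow_one X)
  have h3 : 1 ≤ X ^ (4 * δ) * Y ^ (1 - 4 * δ) :=
    one_le_mul_of_one_le_of_one_le hx1 (Real.one_le_rpow hY (by linarith))
  have := max_le h1 h2
  linarith

theorem phase_weight_le {δ N X Y z A B : ℝ} (hδ : 0 < δ) (hδ' : δ ≤ 1 / 400) (hN : 1 ≤ N)
    (hNX : N < X) (hXY : X ^ ((1:ℝ) - 1/100) ≤ Y) (hz0 : 0 ≤ z)
    (hz : z ≤ 343 * max (Y ^ ((1:ℝ) - 1/100)) (X ^ ((1:ℝ) - 1/100)))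
    (hA0 : 0 ≤ A) (hA : A ≤ 2 * (X * Y)) (hB0 : 0 ≤ B) (hB : B ≤ 344 * (X * Y)) :
    X ^ δ * A ^ δ * B ^ δ * (1 / (X * Y)) ^ 2 ≤
      2 ^ δ * 344 ^ δ * 344 ^ (1 + δ) * N ^ (-1 + 9 * δ) *
        ((1 + X) / 2) ^ (-(1 + δ)) * ((1 + Y) / 2) ^ (-(1 + δ)) * ((1 + z) / 2) ^ (-(1 + δ)) := by
  have hX1 : 1 ≤ X := by linarith
  have hX0 : 0 < X := by linarith
  have hY1 : 1 ≤ Y := (Real.one_le_rpow hX1 (by norm_num)).trans hXY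
  have hY0 : 0 < Y := by linarith
  have hXY0 : 0 < X * Y := mul_pos hX0 hY0
  have hN0 : 0 < N := by linarith
  have hone := one_add_le_of_nearly_resonant hδ hδ' hX1 hXY hz
  have hlogX : Real.log N ≤ Real.log X := Real.log_le_log hN0 hNX.le
  have hlogN : 0 ≤ Real.log N := Real.log_nonneg hN
  have hlogY : 0 ≤ Real.log Y := Real.log_nonneg hY1
  calc X ^ δ * A ^ δ * B ^ δ * (1 / (X * Y)) ^ 2
      ≤ X ^ δ * (2 * (X * Y)) ^ δ * (344 * (X * Y)) ^ δ * (1 / (X * Y)) ^ 2 := by gcongr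
    _ = 2 ^ δ * 344 ^ δ *
          Real.exp ((3 * δ - 2) * Real.log X + (2 * δ - 2) * Real.log Y) := by
        have e2 : (1 / (X * Y)) ^ 2 = X ^ (-2:ℝ) * Y ^ (-2:ℝ) := by
          rw [Real.rpow_neg hX0.le, Real.rpow_neg hY0.le, Real.rpow_two, Real.rpow_two]
          field_simp
        rw [e2, Real.mul_rpow two_pos.le hXY0.le, Real.mul_rpow (by norm_num) hXY0.le,
          Real.mul_rpow hX0.le hY0.le]
        simp only [Real.rpow_def_of_pos hX0, Real.rpow_def_of_pos hY0]
        have : Real.exp ((3 * δ - 2) * Real.log X + (2 * δ - 2) * Real.log Y) =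
          Real.exp (Real.log X * δ) * (Real.exp (Real.log X * δ) * Real.exp (Real.log Y * δ)) *
          (Real.exp (Real.log X * δ) * Real.exp (Real.log Y * δ)) *
          (Real.exp (Real.log X * -2) * Real.exp (Real.log Y * -2)) := by
          simp only [← Real.exp_add]; congr 1; ring
        rw [this]; ring
    _ ≤ 2 ^ δ * 344 ^ δ * Real.exp ((-1 + 9 * δ) * Real.log N - (1 + δ) * Real.log X
          - (1 + δ) * Real.log Y
          - (1 + δ) * (4 * δ * Real.log X + (1 - 4 * δ) * Real.log Y)) := by
        gcongr
        have h1 : (1 - 9 * δ) * Real.log N ≤ (1 - 9 * δ) * Real.log X := by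
          gcongr; linarith
        have h2 : 0 ≤ δ ^ 2 * Real.log Y := by positivity
        have h3 : 0 ≤ δ * (1 - 4 * δ) * Real.log X :=
          mul_nonneg (mul_nonneg hδ.le (by linarith)) (by linarith)
        nlinarith
    _ = 2 ^ δ * 344 ^ δ * 344 ^ (1 + δ) * N ^ (-1 + 9 * δ) *
          X ^ (-(1 + δ)) * Y ^ (-(1 + δ)) *
          (344 * (X ^ (4 * δ) * Y ^ (1 - 4 * δ))) ^ (-(1 + δ)) := by
        rw [Real.mul_rpow (by norm_num) (by positivity), Real.mul_rpow (by positivity)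
          (by positivity), Real.rpow_neg (by norm_num : (0:ℝ) ≤ 344)]
        have h344 : (344:ℝ) ^ (1 + δ) * (344 ^ (1 + δ))⁻¹ = 1 :=
          mul_inv_cancel₀ (by positivity)
        rw [← Real.rpow_mul hX0.le, ← Real.rpow_mul hY0.le]
        simp only [Real.rpow_def_of_pos hX0, Real.rpow_def_of_pos hY0, Real.rpow_def_of_pos hN0]
        have : Real.exp ((-1 + 9 * δ) * Real.log N - (1 + δ) * Real.log X
          - (1 + δ) * Real.log Y
          - (1 + δ) * (4 * δ * Real.log X + (1 - 4 * δ) * Real.log Y)) =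
          Real.exp (Real.log N * (-1 + 9 * δ)) * Real.exp (Real.log X * -(1 + δ)) *
          Real.exp (Real.log Y * -(1 + δ)) * (Real.exp (Real.log X * (4 * δ * -(1 + δ))) *
          Real.exp (Real.log Y * ((1 - 4 * δ) * -(1 + δ)))) := by
          simp only [← Real.exp_add]; congr 1; ring
        rw [this]
        linear_combination (-(2 ^ δ * 344 ^ δ * (Real.exp (Real.log N * (-1 + 9 * δ)) *
          Real.exp (Real.log X * -(1 + δ)) *
          Real.exp (Real.log Y * -(1 + δ)) * (Real.exp (Real.log X * (4 * δ * -(1 + δ))) *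
          Real.exp (Real.log Y * ((1 - 4 * δ) * -(1 + δ))))))) * h344
    _ ≤ _ := by
        have hs : -(1 + δ) ≤ 0 := by linarith
        gcongr ?_ * ?_ * ?_ * ?_
        · exact Real.rpow_le_rpow_of_nonpos (by linarith) (by linarith) hs
        · exact Real.rpow_le_rpow_of_nonpos (by linarith) (by linarith) hs
        · exact Real.rpow_le_rpow_of_nonpos (by linarith) (by linarith) hs

theorem summable_half_one_add_abs_int_rpow {s : ℝ} (hs : 1 < s) :
    Summable fun k : ℤ => ((1 + |(k:ℝ)|) / 2) ^ (-s) := by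
  have h := (Real.summable_abs_int_rpow hs).mul_left ((2:ℝ) ^ s)
  refine Summable.of_norm_bounded_eventually h ?_
  filter_upwards [(Set.finite_singleton (0:ℤ)).compl_mem_cofinite] with k hk
  have hk' : 0 < |(k:ℝ)| := abs_pos.mpr (Int.cast_ne_zero.mpr hk)
  rw [Real.norm_of_nonneg (by positivity)]
  calc ((1 + |(k:ℝ)|) / 2) ^ (-s) ≤ (|(k:ℝ)| / 2) ^ (-s) :=
        Real.rpow_le_rpow_of_nonpos (by positivity) (by linarith) (by linarith)
    _ = 2 ^ s * |(k:ℝ)| ^ (-s) := by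
        rw [Real.div_rpow hk'.le two_pos.le, Real.rpow_neg two_pos.le, div_inv_eq_mul, mul_comm]

theorem cond11.phase_bounds {N : ℝ} {n : ℤ} {q : Triple3} (h : cond11 N n q) (hN : 1 ≤ N) :
    |(mu1 n q : ℝ)| ^ ((1:ℝ) - 1/100) ≤ |(mut2 n q : ℝ)| ∧
    |(mu2 q : ℝ)| ≤ 2 * (|(mu1 n q : ℝ)| * |(mut2 n q : ℝ)|) ∧
    |(mu3 q : ℝ)| ≤ 344 * (|(mu1 n q : ℝ)| * |(mut2 n q : ℝ)|) := by
  obtain ⟨-, -, -, -, -, -, -, -, -, h1, h2, h3⟩ := h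
  have e2 : (mu2 q : ℝ) = mut2 n q - mu1 n q := by rw [mut2]; push_cast; ring
  have e3 : (mu3 q : ℝ) = mut3 n q - mut2 n q := by rw [mut3]; push_cast; ring
  rw [e2, e3]
  set X := |(mu1 n q : ℝ)| with hX
  set Y := |(mut2 n q : ℝ)| with hY
  have hX1 : 1 ≤ X := by linarith
  have hXp : 1 ≤ X ^ ((1:ℝ) - 1/100) := Real.one_le_rpow hX1 (by norm_num)
  have hXY : X ^ ((1:ℝ) - 1/100) ≤ Y := by linarith
  have hY1 : 1 ≤ Y := hXp.trans hXY
  have hYp : Y ^ ((1:ℝ) - 1/100) ≤ Y :=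
    (Real.rpow_le_rpow_of_exponent_le hY1 (by norm_num)).trans_eq (Real.rpow_one Y)
  have hmax := max_le hYp hXY
  have hp : Y ≤ X * Y := le_mul_of_one_le_left (by linarith) hX1
  have hp' : X ≤ X * Y := le_mul_of_one_le_right (by linarith) hY1
  have t2 := abs_sub (mut2 n q : ℝ) (mu1 n q)
  have t3 := abs_sub (mut3 n q : ℝ) (mut2 n q)
  refine ⟨hXY, ?_, ?_⟩ <;> linarith

theorem sum_mul_mul_le_tsum_pow_three {f : ℤ → ℝ} (hf : Summable f) (hf0 : ∀ k, 0 ≤ f k)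
    (T : Finset (ℤ × ℤ × ℤ)) :
    ∑ t ∈ T, f t.1 * (f t.2.1 * f t.2.2) ≤ (∑' k, f k) ^ 3 := by
  have h2 : Summable fun t : ℤ × ℤ => f t.1 * f t.2 := hf.mul_of_nonneg hf hf0 hf0
  have h3 : Summable fun t : ℤ × ℤ × ℤ => f t.1 * (f t.2.1 * f t.2.2) :=
    hf.mul_of_nonneg h2 hf0 fun t => mul_nonneg (hf0 _) (hf0 _)
  calc _ ≤ ∑' t : ℤ × ℤ × ℤ, f t.1 * (f t.2.1 * f t.2.2) :=
        h3.sum_le_tsum _ fun t _ => mul_nonneg (hf0 _) (mul_nonneg (hf0 _) (hf0 _))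
    _ = (∑' k, f k) ^ 3 := by
        rw [← hf.tsum_mul_tsum h2 h3, ← hf.tsum_mul_tsum hf h2]; ring

theorem exists_sum_phase_weight_le {ε : ℝ} (hε : 0 < ε) :
    ∃ C > (0:ℝ), ∀ N : ℝ, 1 ≤ N → ∀ n : ℤ, ∀ F : Finset Triple3, (∀ q ∈ F, cond11 N n q) →
      ∑ q ∈ F, (1 / (|(mu1 n q : ℝ)| * |(mut2 n q : ℝ)|)) ^ 2 ≤ C * N ^ (-1 + 2 * ε) := by
  set δ : ℝ := min (1 / 400) (2 * ε / 9) with hδdef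
  have hδ : 0 < δ := by positivity
  have hδ' : δ ≤ 1 / 400 := min_le_left _ _
  have hδε : 9 * δ ≤ 2 * ε := by linarith [min_le_right (1 / 400) (2 * ε / 9)]
  obtain ⟨D, hD, hdiv⟩ := exists_card_intDivisors_le_rpow hδ
  set f : ℤ → ℝ := fun k => ((1 + |(k:ℝ)|) / 2) ^ (-(1 + δ)) with hf
  have hf0 : ∀ k, 0 ≤ f k := fun k => by positivity
  have hfs : Summable f := summable_half_one_add_abs_int_rpow (by linarith)
  have hS : 0 < ∑' k, f k := hfs.tsum_pos hf0 0 (by simp only [hf]; positivity)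
  set K : ℝ := D ^ 3 * (2 ^ δ * 344 ^ δ * 344 ^ (1 + δ)) with hK
  refine ⟨K * (∑' k, f k) ^ 3, by positivity, fun N hN n F hF => ?_⟩
  set φ : Triple3 → ℤ × ℤ × ℤ := fun q => (mu1 n q, mut2 n q, mut3 n q) with hφ
  have hNε : N ^ (-1 + 9 * δ) ≤ N ^ (-1 + 2 * ε) :=
    Real.rpow_le_rpow_of_exponent_le hN (by linarith)
  have hfiber : ∀ t ∈ F.image φ,
      ∑ q ∈ F with φ q = t, (1 / (|(mu1 n q : ℝ)| * |(mut2 n q : ℝ)|)) ^ 2 ≤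
        K * N ^ (-1 + 2 * ε) * (f t.1 * (f t.2.1 * f t.2.2)) := by
    intro t ht
    obtain ⟨q₀, hq₀, rfl⟩ := Finset.mem_image.mp ht
    have hc := hF q₀ hq₀
    obtain ⟨b1, b2, b3⟩ := hc.phase_bounds hN
    obtain ⟨k1, k2, k3⟩ := hc.mu_ne_zero
    have hcard : ((F.filter fun q => φ q = φ q₀).card : ℝ) ≤
        (D * |(mu1 n q₀ : ℝ)| ^ δ) * (D * |(mu2 q₀ : ℝ)| ^ δ) * (D * |(mu3 q₀ : ℝ)| ^ δ) := by
      have hle : (F.filter fun q => φ q = φ q₀).card ≤ (intDivisors (mu1 n q₀)).card *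
          (intDivisors (mu2 q₀)).card * (intDivisors (mu3 q₀)).card := by
        refine card_le_of_phases (N := N) (n := n) fun q hq => ?_
        obtain ⟨hqF, hqe⟩ := Finset.mem_filter.mp hq
        simp only [hφ, mut3, mut2, Prod.mk.injEq] at hqe
        exact ⟨hF q hqF, by omega, by omega, by omega⟩
      calc _ ≤ ((intDivisors (mu1 n q₀)).card : ℝ) * (intDivisors (mu2 q₀)).card *
            (intDivisors (mu3 q₀)).card := by exact_mod_cast hle
        _ ≤ _ := by
          gcongr
          exacts [hdiv _ k1, hdiv _ k2, hdiv _ k3]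
    have hw := phase_weight_le hδ hδ' hN hc.2.2.2.2.2.2.2.2.2.1 b1 (abs_nonneg _)
      hc.2.2.2.2.2.2.2.2.2.2.2 (abs_nonneg _) b2 (abs_nonneg _) b3
    have hsum : ∑ q ∈ F with φ q = φ q₀, (1 / (|(mu1 n q : ℝ)| * |(mut2 n q : ℝ)|)) ^ 2 =
        (F.filter fun q => φ q = φ q₀).card *
          (1 / (|(mu1 n q₀ : ℝ)| * |(mut2 n q₀ : ℝ)|)) ^ 2 := by
      rw [← nsmul_eq_mul]
      refine Finset.sum_eq_card_nsmul fun q hq => ?_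
      have hqe := (Finset.mem_filter.mp hq).2
      simp only [hφ, Prod.mk.injEq] at hqe
      rw [hqe.1, hqe.2.1]
    rw [hsum]
    calc _ ≤ (D * |(mu1 n q₀ : ℝ)| ^ δ) * (D * |(mu2 q₀ : ℝ)| ^ δ) * (D * |(mu3 q₀ : ℝ)| ^ δ) *
          (1 / (|(mu1 n q₀ : ℝ)| * |(mut2 n q₀ : ℝ)|)) ^ 2 := by gcongr
      _ = D ^ 3 * (|(mu1 n q₀ : ℝ)| ^ δ * |(mu2 q₀ : ℝ)| ^ δ * |(mu3 q₀ : ℝ)| ^ δ *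
          (1 / (|(mu1 n q₀ : ℝ)| * |(mut2 n q₀ : ℝ)|)) ^ 2) := by ring
      _ ≤ D ^ 3 * (2 ^ δ * 344 ^ δ * 344 ^ (1 + δ) * N ^ (-1 + 9 * δ) *
          f (mu1 n q₀) * f (mut2 n q₀) * f (mut3 n q₀)) := by gcongr
      _ = K * N ^ (-1 + 9 * δ) * (f (mu1 n q₀) * (f (mut2 n q₀) * f (mut3 n q₀))) := by
          rw [hK]; ring
      _ ≤ _ := mul_le_mul_of_nonneg_right (by gcongr)
          (mul_nonneg (hf0 _) (mul_nonneg (hf0 _) (hf0 _)))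
  calc _ = ∑ t ∈ F.image φ, ∑ q ∈ F with φ q = t,
          (1 / (|(mu1 n q : ℝ)| * |(mut2 n q : ℝ)|)) ^ 2 :=
        (Finset.sum_fiberwise_of_maps_to (fun q hq => Finset.mem_image_of_mem φ hq) _).symm
    _ ≤ ∑ t ∈ F.image φ, K * N ^ (-1 + 2 * ε) * (f t.1 * (f t.2.1 * f t.2.2)) :=
        Finset.sum_le_sum hfiber
    _ = K * N ^ (-1 + 2 * ε) * ∑ t ∈ F.image φ, f t.1 * (f t.2.1 * f t.2.2) := by
        rw [Finset.mul_sum]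
    _ ≤ K * N ^ (-1 + 2 * ε) * (∑' k, f k) ^ 3 := by
        gcongr
        exact sum_mul_mul_le_tsum_pow_three hfs hf0 _
    _ = _ := by ring

/-- The product of the seven factors of `term11`. -/
noncomputable def septicProd (v : ℤ → ℂ) (q : Triple3) : ℝ :=
  ‖v q.2.2.1‖ * ‖v q.2.2.2.1‖ * ‖v q.2.2.2.2‖ *
    ‖v q.2.1.2.1‖ * ‖v q.2.1.2.2‖ * ‖v q.1.2.1‖ * ‖v q.1.2.2‖

/-- The frequencies entering the septic product determine the output frequency and all the
others. -/
theorem septic_frequencies_injective (N : ℝ) : Function.Injective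
    fun s : (Σ n : ℤ, {q : Triple3 // cond11 N n q}) =>
      (s.2.1.2.2.1, s.2.1.2.2.2.1, s.2.1.2.2.2.2, s.2.1.2.1.2.1, s.2.1.2.1.2.2,
        s.2.1.1.2.1, s.2.1.1.2.2) := by
  rintro ⟨n, ⟨⟨n1, n2, n3⟩, ⟨m1, m2, m3⟩, ⟨p1, p2, p3⟩⟩, hc⟩
    ⟨n', ⟨⟨n1', n2', n3'⟩, ⟨m1', m2', m3'⟩, ⟨p1', p2', p3'⟩⟩, hc'⟩ h
  obtain ⟨e1, -, -, e2, -, -, e3, -⟩ := id hc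
  obtain ⟨e1', -, -, e2', -, -, e3', -⟩ := id hc'
  simp only [Prod.mk.injEq] at h e1 e2 e3 e1' e2' e3'
  obtain ⟨rfl, rfl, rfl, rfl, rfl, rfl, rfl⟩ := h
  obtain rfl : m1' = m1 := by omega
  obtain rfl : n1' = n1 := by omega
  obtain rfl : n' = n := by omega
  rfl

theorem hasSum_prod_mul_of_nonneg {α β : Type*} {f : α → ℝ} {g : β → ℝ} {a b : ℝ}
    (hf : ∀ x, 0 ≤ f x) (hg : ∀ y, 0 ≤ g y) (hfa : HasSum f a) (hgb : HasSum g b) :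
    HasSum (fun p : α × β => f p.1 * g p.2) (a * b) :=
  hfa.mul hgb (hfa.summable.mul_of_nonneg hgb.summable hf hg)

theorem summable_septicProd_sq (N : ℝ) {v : ℤ → ℂ} (hv : Memℓ2 v) :
    Summable (fun s : (Σ n : ℤ, {q : Triple3 // cond11 N n q}) => septicProd v s.2.1 ^ 2) ∧
    ∑' s : (Σ n : ℤ, {q : Triple3 // cond11 N n q}), septicProd v s.2.1 ^ 2 ≤
      (∑' n, ‖v n‖ ^ 2) ^ 7 := by
  set w : ℤ → ℝ := fun n => ‖v n‖ ^ 2 with hw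
  have hw0 : ∀ n, 0 ≤ w n := fun n => by positivity
  have h1 : HasSum w (∑' n, w n) := Summable.hasSum hv
  have h2 := hasSum_prod_mul_of_nonneg hw0 hw0 h1 h1
  have h3 := hasSum_prod_mul_of_nonneg hw0 (fun _ => by positivity) h1 h2
  have h4 := hasSum_prod_mul_of_nonneg hw0 (fun _ => by positivity) h1 h3
  have h5 := hasSum_prod_mul_of_nonneg hw0 (fun _ => by positivity) h1 h4
  have h6 := hasSum_prod_mul_of_nonneg hw0 (fun _ => by positivity) h1 h5
  have h7 := hasSum_prod_mul_of_nonneg hw0 (fun _ => by positivity) h1 h6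
  have hcomp : (fun s : (Σ n : ℤ, {q : Triple3 // cond11 N n q}) => septicProd v s.2.1 ^ 2) =
      (fun t : ℤ × ℤ × ℤ × ℤ × ℤ × ℤ × ℤ => w t.1 * (w t.2.1 * (w t.2.2.1 * (w t.2.2.2.1 *
        (w t.2.2.2.2.1 * (w t.2.2.2.2.2.1 * w t.2.2.2.2.2.2)))))) ∘
      fun s => (s.2.1.2.2.1, s.2.1.2.2.2.1, s.2.1.2.2.2.2, s.2.1.2.1.2.1, s.2.1.2.1.2.2,
        s.2.1.1.2.1, s.2.1.1.2.2) := by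
    funext s
    simp only [septicProd, hw, Function.comp]
    ring
  rw [hcomp]
  refine ⟨h7.summable.comp_injective (septic_frequencies_injective N), ?_⟩
  calc _ ≤ _ := tsum_comp_le_tsum_of_inj h7.summable (fun _ => by positivity)
        (septic_frequencies_injective N)
    _ = _ := by rw [h7.tsum_eq]; ring

theorem sum_term11_le {B N : ℝ} {n : ℤ}
    (hB : ∀ F : Finset Triple3, (∀ q ∈ F, cond11 N n q) →
      ∑ q ∈ F, (1 / (|(mu1 n q : ℝ)| * |(mut2 n q : ℝ)|)) ^ 2 ≤ B)
    {v : ℤ → ℂ} (hs : Summable fun q : {q : Triple3 // cond11 N n q} => septicProd v q.1 ^ 2)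
    (F : Finset {q : Triple3 // cond11 N n q}) :
    ∑ q ∈ F, term11 v n q.1 ≤
      Real.sqrt (B * ∑' q : {q : Triple3 // cond11 N n q}, septicProd v q.1 ^ 2) := by
  refine Real.le_sqrt_of_sq_le ?_
  have hB' : ∑ q ∈ F, (1 / (|(mu1 n q.1 : ℝ)| * |(mut2 n q.1 : ℝ)|)) ^ 2 ≤ B := by
    have := hB (F.map (Function.Embedding.subtype _)) fun q hq => by
      obtain ⟨q', -, rfl⟩ := Finset.mem_map.mp hq
      exact q'.2
    rwa [Finset.sum_map] at this
  calc (∑ q ∈ F, term11 v n q.1) ^ 2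
      ≤ (∑ q ∈ F, (1 / (|(mu1 n q.1 : ℝ)| * |(mut2 n q.1 : ℝ)|)) ^ 2) *
          ∑ q ∈ F, septicProd v q.1 ^ 2 := Finset.sum_mul_sq_le_sq_mul_sq _ _ _
    _ ≤ _ := mul_le_mul hB' (hs.sum_le_tsum _ fun _ _ => by positivity)
          (Finset.sum_nonneg fun _ _ => by positivity)
          ((Finset.sum_nonneg fun _ _ => by positivity).trans hB')

/-- **Bound on the nearly resonant septic term of the third generation.** For every `ε > 0`
there is `C > 0` such that for all `N ≥ 1` and `v ∈ ℓ²(ℤ;ℂ)`: `Q(n)` is finite for each `n`,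
belongs to `ℓ²(ℤ)`, and `‖Q‖ ≤ C N^{−1/2+ε} ‖v‖⁷`. -/
theorem N3_1_bound : ∀ ε > (0:ℝ), ∃ C > (0:ℝ), ∀ N : ℝ, 1 ≤ N → ∀ v : ℤ → ℂ, Memℓ2 v →
    (∀ n : ℤ, Summable fun q : {q : Triple3 // cond11 N n q} => term11 v n q.1) ∧
    Summable (fun n : ℤ => Q11 N v n ^ 2) ∧
    Real.sqrt (∑' n : ℤ, Q11 N v n ^ 2)
      ≤ C * N ^ (-(1:ℝ)/2 + ε) * l2norm v ^ 7 := by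
  intro ε hε
  obtain ⟨C, hC, hweight⟩ := exists_sum_phase_weight_le hε
  refine ⟨Real.sqrt C, Real.sqrt_pos.mpr hC, fun N hN v hv => ?_⟩
  have hN0 : 0 < N := by linarith
  set A : ℝ := ∑' n, ‖v n‖ ^ 2 with hA
  have hA0 : 0 ≤ A := tsum_nonneg fun _ => by positivity
  set B : ℝ := C * N ^ (-1 + 2 * ε) with hB
  have hB0 : 0 ≤ B := by positivity
  obtain ⟨hsum, hle⟩ := summable_septicProd_sq N hv
  have hfib := hsum.sigma_factor
  have hterm0 : ∀ n (q : {q : Triple3 // cond11 N n q}), 0 ≤ term11 v n q.1 := fun n q => by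
    unfold term11; positivity
  have hfin := fun n => sum_term11_le (hweight N hN n) (hfib n)
  have hQsq : ∀ n, Q11 N v n ^ 2 ≤
      B * ∑' q : {q : Triple3 // cond11 N n q}, septicProd v q.1 ^ 2 := fun n => by
    have hG : 0 ≤ ∑' q : {q : Triple3 // cond11 N n q}, septicProd v q.1 ^ 2 :=
      tsum_nonneg fun _ => by positivity
    calc Q11 N v n ^ 2 ≤ _ := pow_le_pow_left₀ (tsum_nonneg (hterm0 n))
          (Real.tsum_le_of_sum_le (hterm0 n) (hfin n)) 2
      _ = _ := Real.sq_sqrt (mul_nonneg hB0 hG)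
  have hmaj := hsum.sigma.mul_left B
  have hQs : Summable fun n : ℤ => Q11 N v n ^ 2 :=
    Summable.of_nonneg_of_le (fun _ => by positivity) hQsq hmaj
  refine ⟨fun n => summable_of_sum_le (hterm0 n) (hfin n), hQs, ?_⟩
  have htot : ∑' n : ℤ, Q11 N v n ^ 2 ≤ B * A ^ 7 :=
    calc _ ≤ _ := hQs.tsum_le_tsum hQsq hmaj
      _ = B * ∑' s : (Σ n : ℤ, {q : Triple3 // cond11 N n q}), septicProd v s.2.1 ^ 2 := by
          rw [tsum_mul_left, hsum.tsum_sigma]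
      _ ≤ B * A ^ 7 := by gcongr
  calc _ ≤ Real.sqrt (B * A ^ 7) := Real.sqrt_le_sqrt htot
    _ = Real.sqrt C * N ^ (-(1:ℝ)/2 + ε) * l2norm v ^ 7 := by
        rw [Real.sqrt_eq_iff_mul_self_eq (by positivity) (by unfold l2norm; positivity)]
        have h1 : Real.sqrt C * Real.sqrt C = C := Real.mul_self_sqrt hC.le
        have h2 : N ^ (-(1:ℝ)/2 + ε) * N ^ (-(1:ℝ)/2 + ε) = N ^ (-1 + 2 * ε) := by
          rw [← Real.rpow_add hN0]; congr 1; ring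
        have h3 : l2norm v ^ 7 * l2norm v ^ 7 = A ^ 7 := by
          rw [← mul_pow]; exact congrArg (· ^ 7) (Real.mul_self_sqrt hA0)
        calc B * A ^ 7 = (Real.sqrt C * Real.sqrt C) *
              (N ^ (-(1:ℝ)/2 + ε) * N ^ (-(1:ℝ)/2 + ε)) *
              (l2norm v ^ 7 * l2norm v ^ 7) := by rw [h1, h2, h3]
          _ = _ := by ring
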